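/- arXiv:2501.00266 — 2 statements merged into one kernel-verified Lean document; each statement's English description precedes it below -/
import Mathlib

section
/- Let F be a one-step skew product satisfying conditions (H0), (H1), (H2), and the following asymptotic occupational time condition (OT1): there exist x₀, x₁, γ₀, γ₁ ∈ (0,1) with γ₀ < γ₁ such that for i = 0,1, limsup_{n→∞} (1/n)∑_{j=0}^{n-1} 1_{I_i(γ_i)}(f_ω^j(x_i)) = 1 for ℙ-almost every ω. Then for every x ∈ (0,1), for ℙ-almost every ω ∈ Ω: liminf_{n→∞} (1/n)∑_{j=0}^{n-1} f_ω^j(x) ≤ γ₀ and limsup_{n→∞} (1/n)∑_{j=0}^{n-1} f_ω^j(x) ≥ γ₁. -/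
open MeasureTheory Filter Set

noncomputable section

/-- Fiber compositions of a one-step skew product:
`fib f ω n = f_{ω_{n-1}} ∘ ⋯ ∘ f_{ω_0}`. -/
def fib {𝒜 : Type*} (f : 𝒜 → ℝ → ℝ) (ω : ℕ → 𝒜) : ℕ → ℝ → ℝ
  | 0 => id
  | n + 1 => f (ω n) ∘ fib f ω n

/-- `ℙ` is the Bernoulli product measure `p^ℕ` on `𝒜^ℕ`, characterized by its values on
cylinder sets. -/
def IsBernoulli {𝒜 : Type*} [MeasurableSpace 𝒜] (p : Measure 𝒜) (ℙ : Measure (ℕ → 𝒜)) : Prop :=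
  ∀ (n : ℕ) (s : Fin n → Set 𝒜), (∀ i, MeasurableSet (s i)) →
    ℙ {ω : ℕ → 𝒜 | ∀ i : Fin n, ω (i : ℕ) ∈ s i} = ∏ i, p (s i)

/-- The tail σ-algebra generated by the real random variables `X m, X (m+1), …`
is `ℙ`-trivial. -/
def TailTrivial {Ω : Type*} [MeasurableSpace Ω] (ℙ : Measure Ω) (X : ℕ → Ω → ℝ) : Prop :=
  ∀ s : Set Ω,
    MeasurableSet[⨅ m : ℕ, ⨆ (n : ℕ) (_ : m ≤ n),
      MeasurableSpace.comap (X n) (inferInstance : MeasurableSpace ℝ)] s →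
    ℙ s = 0 ∨ ℙ s = 1

/-- Sequences whose Cesàro averages are frequently below `γ + ε` for every `ε`. -/
def TT (γ : ℝ) : Set (ℕ → ℝ) :=
  {u | ∀ k : ℕ, ∀ N : ℕ, ∃ n : ℕ, N ≤ n ∧
    ∑ j ∈ Finset.range n, u j < n * (γ + 1 / ((k : ℝ) + 1))}

lemma measurableSet_TT (γ : ℝ) : MeasurableSet (TT γ) := by
  have : TT γ = ⋂ k : ℕ, ⋂ N : ℕ, ⋃ n : ℕ, ⋃ (_ : N ≤ n),
      {u : ℕ → ℝ | ∑ j ∈ Finset.range n, u j < n * (γ + 1 / ((k : ℝ) + 1))} := by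
    ext u; simp [TT]
  rw [this]
  refine MeasurableSet.iInter fun k => MeasurableSet.iInter fun N => MeasurableSet.iUnion fun n =>
    MeasurableSet.iUnion fun _ => measurableSet_lt ?_ measurable_const
  fun_prop

lemma TT_shift (γ : ℝ) (hγ : 0 ≤ γ) (u : ℕ → ℝ) (hu : ∀ n, u n ∈ Ioo (0:ℝ) 1) :
    u ∈ TT γ ↔ (fun n => u (n + 1)) ∈ TT γ := by
  have key : ∀ (k : ℕ) (n : ℕ), 2 * ((k:ℝ) + 1) * (γ + 1) ≤ n →
      γ + 1 ≤ n * (1 / ((k:ℝ) + 1) - 1 / (((2 * k + 1 : ℕ) : ℝ) + 1)) := by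
    intro k n hn
    have hk : (0:ℝ) < (k:ℝ) + 1 := by positivity
    have : (1 / ((k:ℝ) + 1) - 1 / (((2 * k + 1 : ℕ) : ℝ) + 1)) = 1 / (2 * ((k:ℝ) + 1)) := by
      push_cast
      have : (2 * (k:ℝ) + 1 + 1) = 2 * ((k:ℝ) + 1) := by ring
      rw [this]; field_simp; ring
    rw [this, mul_one_div, le_div_iff₀ (by positivity)]
    linarith
  constructor
  · intro h k N
    obtain ⟨M, hM⟩ := exists_nat_ge (2 * ((k:ℝ) + 1) * (γ + 1))
    obtain ⟨n, hn, hs⟩ := h (2 * k + 1) (max N M + 1)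
    obtain ⟨n, rfl⟩ : ∃ m, n = m + 1 := ⟨n - 1, by omega⟩
    refine ⟨n, by omega, ?_⟩
    rw [Finset.sum_range_succ'] at hs
    have h0 := (hu 0).1
    have hMn : (M:ℝ) ≤ n := by exact_mod_cast (by omega : M ≤ n)
    have := key k n (hM.trans hMn)
    have h1 : 1 / (((2 * k + 1 : ℕ) : ℝ) + 1) ≤ 1 := by
      rw [div_le_one (by positivity)]; push_cast; linarith [Nat.cast_nonneg (α := ℝ) k]
    rw [Nat.cast_succ] at hs
    nlinarith
  · intro h k N
    obtain ⟨M, hM⟩ := exists_nat_ge (2 * ((k:ℝ) + 1) * (γ + 1))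
    obtain ⟨n, hn, hs⟩ := h (2 * k + 1) (max N M)
    refine ⟨n + 1, by omega, ?_⟩
    rw [Finset.sum_range_succ']
    have h0 := (hu 0).2
    have hMn : (M:ℝ) ≤ n := by exact_mod_cast (by omega : M ≤ n)
    have := key k n (hM.trans hMn)
    have h1 : 0 < 1 / ((k : ℝ) + 1) := by positivity
    rw [Nat.cast_succ]
    nlinarith

lemma TT_of_limsup (γ : ℝ) (hγ : γ ∈ Ioo (0:ℝ) 1) (u i : ℕ → ℝ)
    (hi : ∀ n, i n ∈ Icc (0:ℝ) 1) (hui : ∀ n, u n ≤ 1 - (1 - γ) * i n)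
    (h : limsup (fun n : ℕ => (n:ℝ)⁻¹ * ∑ j ∈ Finset.range n, i j) atTop = 1) : u ∈ TT γ := by
  intro k N
  have hk : (0:ℝ) < 1 / ((k:ℝ) + 1) := by positivity
  have hf : ∃ᶠ n : ℕ in atTop, 1 - 1 / ((k:ℝ) + 1) <
      (n:ℝ)⁻¹ * ∑ j ∈ Finset.range n, i j := by
    refine frequently_lt_of_lt_limsup ?_ (by rw [h]; linarith)
    refine IsBoundedUnder.isCoboundedUnder_le ⟨0, ?_⟩
    simp only [eventually_map]
    refine Eventually.of_forall fun n => ?_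
    exact mul_nonneg (by positivity) (Finset.sum_nonneg fun j _ => (hi j).1)
  obtain ⟨n, hn, hs⟩ := (frequently_atTop.1 hf) (N + 1)
  refine ⟨n, by omega, ?_⟩
  have hn0 : (0:ℝ) < n := by exact_mod_cast (by omega : 0 < n)
  have h1 : ∑ j ∈ Finset.range n, u j ≤ n - (1 - γ) * ∑ j ∈ Finset.range n, i j := by
    calc _ ≤ ∑ j ∈ Finset.range n, (1 - (1 - γ) * i j) := Finset.sum_le_sum fun j _ => hui j
      _ = _ := by rw [Finset.sum_sub_distrib, ← Finset.mul_sum]; simp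
  rw [inv_mul_eq_div, lt_div_iff₀ hn0] at hs
  have h2 := mul_lt_mul_of_pos_left hs (sub_pos.2 hγ.2)
  have h3 : 0 < γ * (n * (1 / ((k:ℝ) + 1))) := mul_pos hγ.1 (by positivity)
  nlinarith

section
variable {𝒜 : Type*}

lemma fib_mem (f : 𝒜 → ℝ → ℝ) (hm : ∀ c, MapsTo (f c) (Ioo (0:ℝ) 1) (Ioo (0:ℝ) 1))
    (ω : ℕ → 𝒜) {x : ℝ} (hx : x ∈ Ioo (0:ℝ) 1) (n : ℕ) : fib f ω n x ∈ Ioo (0:ℝ) 1 := by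
  induction n with
  | zero => exact hx
  | succ n ih => exact hm _ ih

lemma fib_succ' (f : 𝒜 → ℝ → ℝ) (ω : ℕ → 𝒜) (x : ℝ) (n : ℕ) :
    fib f ω (n + 1) x = fib f (fun k => ω (k + 1)) n (f (ω 0) x) := by
  induction n with
  | zero => rfl
  | succ n ih =>
    show f (ω (n+1)) (fib f ω (n+1) x) = _
    rw [ih]; rfl

lemma fib_mono (f : 𝒜 → ℝ → ℝ) (hm : ∀ c, MapsTo (f c) (Ioo (0:ℝ) 1) (Ioo (0:ℝ) 1))
    (hmo : ∀ c, MonotoneOn (f c) (Ioo (0:ℝ) 1))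
    (ω : ℕ → 𝒜) {x y : ℝ} (hx : x ∈ Ioo (0:ℝ) 1) (hy : y ∈ Ioo (0:ℝ) 1) (hxy : x ≤ y) (n : ℕ) :
    fib f ω n x ≤ fib f ω n y := by
  induction n with
  | zero => exact hxy
  | succ n ih => exact hmo _ (fib_mem f hm ω hx n) (fib_mem f hm ω hy n) ih

/-- `y` is reachable from `x`. -/
def Rch (f : 𝒜 → ℝ → ℝ) : ℝ → ℝ → Prop := Relation.ReflTransGen (fun y z => ∃ c, z = f c y)

lemma Rch_fib (f : 𝒜 → ℝ → ℝ) (ω : ℕ → 𝒜) (x : ℝ) (n : ℕ) : Rch f x (fib f ω n x) := by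
  induction n with
  | zero => exact Relation.ReflTransGen.refl
  | succ n ih => exact Relation.ReflTransGen.tail ih ⟨ω n, rfl⟩

lemma Rch_mem {f : 𝒜 → ℝ → ℝ} (hm : ∀ c, MapsTo (f c) (Ioo (0:ℝ) 1) (Ioo (0:ℝ) 1))
    {x y : ℝ} (hx : x ∈ Ioo (0:ℝ) 1) (h : Rch f x y) : y ∈ Ioo (0:ℝ) 1 := by
  induction h with
  | refl => exact hx
  | tail _ h ih => obtain ⟨c, rfl⟩ := h; exact hm c ih

lemma Rch_mono {f : 𝒜 → ℝ → ℝ} (hm : ∀ c, MapsTo (f c) (Ioo (0:ℝ) 1) (Ioo (0:ℝ) 1))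
    (hmo : ∀ c, MonotoneOn (f c) (Ioo (0:ℝ) 1))
    {x y x' : ℝ} (hx : x ∈ Ioo (0:ℝ) 1) (hx' : x' ∈ Ioo (0:ℝ) 1) (hxx : x ≤ x')
    (h : Rch f x y) : ∃ y', Rch f x' y' ∧ y ≤ y' := by
  induction h with
  | refl => exact ⟨x', Relation.ReflTransGen.refl, hxx⟩
  | @tail b c hb h ih =>
    obtain ⟨a, rfl⟩ := h
    obtain ⟨y', h1, h2⟩ := ih
    exact ⟨f a y', h1.tail ⟨a, rfl⟩, hmo a (Rch_mem hm hx hb) (Rch_mem hm hx' h1) h2⟩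

variable [MeasurableSpace 𝒜]

lemma measurable_fib [Countable 𝒜] [MeasurableSingletonClass 𝒜] (f : 𝒜 → ℝ → ℝ)
    (hfm : ∀ c, Measurable (f c)) (x : ℝ) (n : ℕ) :
    Measurable (fun ω : ℕ → 𝒜 => fib f ω n x) := by
  induction n with
  | zero => exact measurable_const
  | succ n ih =>
    have h : Measurable (fun q : 𝒜 × ℝ => f q.1 q.2) :=
      measurable_from_prod_countable_right hfm
    exact h.comp ((measurable_pi_apply n).prodMk ih)

lemma bernoulli_unique (p : Measure 𝒜) [IsProbabilityMeasure p] (P : Measure (ℕ → 𝒜))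
    (h : IsBernoulli p P) : P = Measure.infinitePi (fun _ : ℕ => p) := by
  classical
  refine Measure.eq_infinitePi _ ?_
  intro s t ht
  have := h (s.sup id + 1) (fun i => if (i:ℕ) ∈ s then t i else univ) (by
    intro i; split_ifs
    · exact ht _
    · exact MeasurableSet.univ)
  have hs : ∀ i ∈ s, i < s.sup id + 1 := fun i hi =>
    Nat.lt_succ_of_le (Finset.le_sup (f := id) hi)
  have e : (Set.pi (s : Set ℕ) t) =
      {ω : ℕ → 𝒜 | ∀ i : Fin (s.sup id + 1), ω (i:ℕ) ∈ if (i:ℕ) ∈ s then t i else univ} := by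
    ext ω
    constructor
    · intro hω i
      split_ifs with hi
      · exact hω _ hi
      · trivial
    · intro hω i hi
      have := hω ⟨i, hs i hi⟩
      simpa [Finset.mem_coe.1 hi] using this
  rw [e, this, Fin.prod_univ_eq_prod_range (fun i => p (if i ∈ s then t i else univ))]
  rw [← Finset.prod_subset (s₁ := s)]
  · exact Finset.prod_congr rfl fun i hi => by simp [hi]
  · intro i hi; exact Finset.mem_range.2 (hs i hi)
  · intro i _ hi; simp [hi]

lemma bernoulli_shift (p : Measure 𝒜) [IsProbabilityMeasure p] (P : Measure (ℕ → 𝒜))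
    (h : IsBernoulli p P) : P.map (fun ω n => ω (n + 1)) = P := by
  have hme : Measurable (fun (ω : ℕ → 𝒜) (n : ℕ) => ω (n + 1)) := by fun_prop
  have h2 : IsBernoulli p (P.map (fun ω n => ω (n + 1))) := by
    intro n s hs
    have hset : MeasurableSet {ω : ℕ → 𝒜 | ∀ i : Fin n, ω (i : ℕ) ∈ s i} := by
      rw [Set.ofPred_forall]
      exact MeasurableSet.iInter fun i => measurable_pi_apply (i:ℕ) (hs i)
    rw [Measure.map_apply hme hset]
    have := h (n + 1) (Fin.cons univ s) (by
      intro i; refine Fin.cases ?_ ?_ i <;> simp [hs])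
    rw [Fin.prod_univ_succ] at this
    simp only [Fin.cons_zero, Fin.cons_succ, measure_univ, one_mul] at this
    rw [← this]
    congr 1
    ext ω
    simp [Fin.forall_fin_succ]
  rw [bernoulli_unique p _ h2, ← bernoulli_unique p _ h]

lemma tail_01 {Ω : Type*} [MeasurableSpace Ω] (P : Measure Ω) (X : ℕ → Ω → ℝ)
    (h : TailTrivial P X) (T : Set (ℕ → ℝ)) (hT : MeasurableSet T)
    (hsh : ∀ m ω, (fun n => X n ω) ∈ T ↔ (fun n => X (n + m) ω) ∈ T) :
    P {ω | (fun n => X n ω) ∈ T} = 0 ∨ P {ω | (fun n => X n ω) ∈ T} = 1 := by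
  apply h
  rw [MeasurableSpace.measurableSet_iInf]
  intro m
  have e : {ω | (fun n => X n ω) ∈ T} = (fun ω n => X (n + m) ω) ⁻¹' T := by
    ext ω; exact hsh m ω
  rw [e]
  have : Measurable[⨆ (n : ℕ) (_ : m ≤ n),
      MeasurableSpace.comap (X n) (inferInstance : MeasurableSpace ℝ)]
      (fun ω n => X (n + m) ω) := by
    refine @measurable_pi_lambda _ _ _ (_) _ _ fun n => ?_
    refine Measurable.mono (comap_measurable (X (n + m))) ?_ le_rfl
    exact le_iSup₂_of_le (n + m) (by omega) le_rfl
  exact this hT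

/-- one-step transfer of almost sure tail properties -/
lemma step_iff [Countable 𝒜] [MeasurableSingletonClass 𝒜]
    (p : Measure 𝒜) [IsProbabilityMeasure p] (hp : ∀ c : 𝒜, 0 < p {c})
    (P : Measure (ℕ → 𝒜)) [IsProbabilityMeasure P] (hPr : IsBernoulli p P)
    (f : 𝒜 → ℝ → ℝ) (hfm : ∀ c, Measurable (f c))
    (hH0 : ∀ x ∈ Ioo (0:ℝ) 1, TailTrivial P fun n ω => fib f ω n x)
    (hm : ∀ c, MapsTo (f c) (Ioo (0:ℝ) 1) (Ioo (0:ℝ) 1))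
    (T : Set (ℕ → ℝ)) (hT : MeasurableSet T)
    (hsh : ∀ u : ℕ → ℝ, (∀ n, u n ∈ Ioo (0:ℝ) 1) → (u ∈ T ↔ (fun n => u (n + 1)) ∈ T))
    (x : ℝ) (hx : x ∈ Ioo (0:ℝ) 1) (c : 𝒜) :
    (∀ᵐ ω ∂P, (fun n => fib f ω n x) ∈ T) ↔ (∀ᵐ ω ∂P, (fun n => fib f ω n (f c x)) ∈ T) := by
  have hsh' : ∀ u : ℕ → ℝ, (∀ n, u n ∈ Ioo (0:ℝ) 1) → ∀ m, (u ∈ T ↔ (fun n => u (n + m)) ∈ T) := by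
    intro u hu m
    induction m with
    | zero => simp
    | succ m ih =>
      rw [ih, hsh _ (fun n => hu _)]
      simp only [add_assoc, add_comm 1 m]
  have h01 : ∀ y ∈ Ioo (0:ℝ) 1, P {ω | (fun n => fib f ω n y) ∈ T} = 0 ∨
      P {ω | (fun n => fib f ω n y) ∈ T} = 1 := by
    intro y hy
    exact tail_01 P (fun n ω => fib f ω n y) (hH0 y hy) T hT
      (fun m ω => hsh' (fun n => fib f ω n y) (fun n => fib_mem f hm ω hy n) m)
  have hms : ∀ y, MeasurableSet {ω : ℕ → 𝒜 | (fun n => fib f ω n y) ∈ T} := fun y =>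
    (measurable_pi_lambda (fun (ω : ℕ → 𝒜) n => fib f ω n y)
      (fun n => measurable_fib f hfm y n)) hT
  have hae : ∀ y, (∀ᵐ ω ∂P, (fun n => fib f ω n y) ∈ T) ↔
      P {ω | (fun n => fib f ω n y) ∈ T} = 1 := fun y =>
    (prob_compl_eq_zero_iff (hms y))
  have hcyl : 0 < P {ω : ℕ → 𝒜 | ω 0 = c} := by
    have := hPr 1 (fun _ => {c}) (fun _ => measurableSet_singleton c)
    simp only [Finset.univ_unique, Finset.prod_const, Finset.card_singleton, pow_one] at this
    have e : {ω : ℕ → 𝒜 | ω 0 = c} = {ω : ℕ → 𝒜 | ∀ i : Fin 1, ω (i:ℕ) ∈ ({c} : Set 𝒜)} := by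
      ext ω; simp
    rw [e, this]; exact hp c
  have hme : Measurable (fun (ω : ℕ → 𝒜) (n : ℕ) => ω (n + 1)) := by fun_prop
  have hmp : MeasurePreserving (fun (ω : ℕ → 𝒜) (n : ℕ) => ω (n + 1)) P P :=
    ⟨hme, bernoulli_shift p P hPr⟩
  have hcx := hm c hx
  -- on the cylinder the two events agree up to shift
  have hag : ∀ ω : ℕ → 𝒜, ω 0 = c → ((fun n => fib f ω n x) ∈ T ↔
      (fun n => fib f (fun k => ω (k + 1)) n (f c x)) ∈ T) := by
    intro ω hω
    rw [hsh _ (fun n => fib_mem f hm ω hx n)]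
    simp only [fib_succ', hω]
  constructor
  · intro h
    rw [hae]
    refine (h01 _ hcx).resolve_left fun h0 => ?_
    have h1 : P ((fun (ω : ℕ → 𝒜) (n : ℕ) => ω (n + 1)) ⁻¹'
        {ω | (fun n => fib f ω n (f c x)) ∈ T}) = 0 := by
      rw [hmp.measure_preimage (hms _).nullMeasurableSet, h0]
    have h2 : P {ω : ℕ → 𝒜 | ω 0 = c} = 0 := by
      refine measure_mono_null ?_ (measure_union_null h1 h)
      intro ω hω
      by_cases hc : (fun n => fib f ω n x) ∈ T
      · left; exact (hag ω hω).1 hc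
      · right; exact hc
    exact hcyl.ne' h2
  · intro h
    rw [hae]
    refine (h01 _ hx).resolve_left fun h0 => ?_
    have h1 := hmp.quasiMeasurePreserving.ae h
    have h2 : P {ω : ℕ → 𝒜 | ω 0 = c} = 0 := by
      refine measure_mono_null ?_ (measure_union_null h0 h1)
      intro ω hω
      by_cases hc : (fun n => fib f ω n x) ∈ T
      · left; exact hc
      · right; exact fun h3 => hc ((hag ω hω).2 h3)
    exact hcyl.ne' h2

lemma core [Countable 𝒜] [MeasurableSingletonClass 𝒜]
    (p : Measure 𝒜) [IsProbabilityMeasure p] (hp : ∀ c : 𝒜, 0 < p {c})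
    (P : Measure (ℕ → 𝒜)) [IsProbabilityMeasure P] (hPr : IsBernoulli p P)
    (f : 𝒜 → ℝ → ℝ) (hfm : ∀ c, Measurable (f c))
    (hH0 : ∀ x ∈ Ioo (0:ℝ) 1, TailTrivial P fun n ω => fib f ω n x)
    (hm : ∀ c, MapsTo (f c) (Ioo (0:ℝ) 1) (Ioo (0:ℝ) 1))
    (hmo : ∀ c, MonotoneOn (f c) (Ioo (0:ℝ) 1))
    (hH2 : ∀ x ∈ Ioo (0:ℝ) 1, ∃ a b : 𝒜, f a x < x ∧ x < f b x)
    (γ : ℝ) (hγ : 0 ≤ γ) (x₀ : ℝ) (hx₀ : x₀ ∈ Ioo (0:ℝ) 1)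
    (h : ∀ᵐ ω ∂P, (fun n => fib f ω n x₀) ∈ TT γ) (x : ℝ) (hx : x ∈ Ioo (0:ℝ) 1) :
    ∀ᵐ ω ∂P, (fun n => fib f ω n x) ∈ TT γ := by
  have rch_iff : ∀ (T : Set (ℕ → ℝ)), MeasurableSet T →
      (∀ u : ℕ → ℝ, (∀ n, u n ∈ Ioo (0:ℝ) 1) → (u ∈ T ↔ (fun n => u (n + 1)) ∈ T)) →
      ∀ y z, y ∈ Ioo (0:ℝ) 1 → Rch f y z →
      ((∀ᵐ ω ∂P, (fun n => fib f ω n y) ∈ T) ↔ (∀ᵐ ω ∂P, (fun n => fib f ω n z) ∈ T)) := by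
    intro T hT hsh y z hy hyz
    induction hyz with
    | refl => rfl
    | tail hb h ih =>
      obtain ⟨c, rfl⟩ := h
      rw [ih]
      exact step_iff p hp P hPr f hfm hH0 hm T hT hsh _ (Rch_mem hm hy hb) c
  -- the combinatorial claim
  have claim : ∃ u v, Rch f x₀ u ∧ Rch f x v ∧ v ≤ u := by
    by_contra hcon
    push Not at hcon
    let D : Set ℝ := {z | z ∈ Ioo (0:ℝ) 1 ∧ ∀ u v, Rch f z u → Rch f x v → u < v}
    have hD0 : x₀ ∈ D := ⟨hx₀, fun u v hu hv => hcon u v hu hv⟩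
    have hDx : ∀ z ∈ D, z < x := fun z hz =>
      hz.2 z x Relation.ReflTransGen.refl Relation.ReflTransGen.refl
    have hbdd : BddAbove D := ⟨x, fun z hz => (hDx z hz).le⟩
    have hDR : ∀ z ∈ D, ∀ w, Rch f z w → w ∈ D := fun z hz w hw =>
      ⟨Rch_mem hm hz.1 hw, fun u v hu hv => hz.2 u v (hw.trans hu) hv⟩
    have hDdown : ∀ z ∈ D, ∀ w ∈ Ioo (0:ℝ) 1, w ≤ z → w ∈ D := by
      intro z hz w hw hwz
      refine ⟨hw, fun u v hu hv => ?_⟩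
      obtain ⟨u', hu', huu⟩ := Rch_mono hm hmo hw hz.1 hwz hu
      exact huu.trans_lt (hz.2 u' v hu' hv)
    set S := sSup D with hS
    have hS1 : S ∈ Ioo (0:ℝ) 1 :=
      ⟨hx₀.1.trans_le (le_csSup hbdd hD0),
        (csSup_le ⟨x₀, hD0⟩ fun z hz => (hDx z hz).le).trans_lt hx.2⟩
    obtain ⟨a, b, ha, hb⟩ := hH2 S hS1
    have hSD : S ∉ D := fun hSD =>
      absurd (le_csSup hbdd (hDR S hSD (f b S) (Relation.ReflTransGen.single ⟨b, rfl⟩)))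
        (not_le.2 hb)
    have hDlt : ∀ z ∈ Ioo (0:ℝ) 1, z < S → z ∈ D := by
      intro z hz hzS
      obtain ⟨w, hw, hzw⟩ := exists_lt_of_lt_csSup ⟨x₀, hD0⟩ hzS
      exact hDdown w hw z hz hzw.le
    have hDS : ∀ z ∈ D, z < S := fun z hz =>
      lt_of_le_of_ne (le_csSup hbdd hz) fun e => hSD (e ▸ hz)
    have hRx : ∀ v, Rch f x v → S ≤ v := by
      intro v hv
      by_contra hlt
      have hvD := hDlt v (Rch_mem hm hx hv) (not_le.1 hlt)
      exact lt_irrefl _ (hvD.2 v v Relation.ReflTransGen.refl hv)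
    obtain ⟨u, v, hu, hv, hvu⟩ : ∃ u v, Rch f S u ∧ Rch f x v ∧ v ≤ u := by
      by_contra hcon'
      push Not at hcon'
      exact hSD ⟨hS1, fun u v hu hv => hcon' u v hu hv⟩
    let T : Set (ℕ → ℝ) := {q | ∃ N : ℕ, ∀ n : ℕ, N ≤ n → q n < S}
    have hTm : MeasurableSet T := by
      have : T = ⋃ N : ℕ, ⋂ n : ℕ, ⋂ (_ : N ≤ n), {q : ℕ → ℝ | q n < S} := by
        ext q; simp [T]
      rw [this]
      refine MeasurableSet.iUnion fun N => MeasurableSet.iInter fun n =>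
        MeasurableSet.iInter fun _ => measurableSet_lt (measurable_pi_apply n) measurable_const
    have hTs : ∀ u : ℕ → ℝ, (∀ n, u n ∈ Ioo (0:ℝ) 1) →
        (u ∈ T ↔ (fun n => u (n + 1)) ∈ T) := by
      intro u _
      constructor
      · rintro ⟨N, hN⟩
        exact ⟨N, fun n hn => hN _ (by omega)⟩
      · rintro ⟨N, hN⟩
        refine ⟨N + 1, fun n hn => ?_⟩
        obtain ⟨n, rfl⟩ : ∃ m, n = m + 1 := ⟨n - 1, by omega⟩
        exact hN n (by omega)
    have r1 := rch_iff T hTm hTs S (f a S) hS1 (Relation.ReflTransGen.single ⟨a, rfl⟩)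
    have r2 := rch_iff T hTm hTs S u hS1 hu
    have h1 : ∀ᵐ ω ∂P, (fun n => fib f ω n (f a S)) ∈ T := by
      refine Eventually.of_forall fun ω => ⟨0, fun n _ => ?_⟩
      exact hDS _ (hDR _ (hDlt _ (hm a hS1) ha) _ (Rch_fib f ω _ n))
    have h2 := r2.1 (r1.2 h1)
    obtain ⟨ω, N, hN⟩ := h2.exists
    have h3 := hN N le_rfl
    have h4 := fib_mono f hm hmo ω (Rch_mem hm hx hv) (Rch_mem hm hS1 hu) hvu N
    have h5 := hRx _ (hv.trans (Rch_fib f ω v N))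
    exact absurd h3 (not_lt.2 (h5.trans h4))
  obtain ⟨u, v, hu, hv, hvu⟩ := claim
  have hu1 := (rch_iff (TT γ) (measurableSet_TT γ) (TT_shift γ hγ) x₀ u hx₀ hu).1 h
  refine (rch_iff (TT γ) (measurableSet_TT γ) (TT_shift γ hγ) x v hx hv).2 ?_
  filter_upwards [hu1] with ω hω k N
  obtain ⟨n, hn, hs⟩ := hω k N
  refine ⟨n, hn, lt_of_le_of_lt (Finset.sum_le_sum fun j _ => ?_) hs⟩
  exact fib_mono f hm hmo ω (Rch_mem hm hx hv) (Rch_mem hm hx₀ hu) hvu j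

end

lemma fib_conj {𝒜 : Type*} (f : 𝒜 → ℝ → ℝ) (ω : ℕ → 𝒜) (n : ℕ) (x : ℝ) :
    fib (fun c y => 1 - f c (1 - y)) ω n x = 1 - fib f ω n (1 - x) := by
  induction n with
  | zero => simp [fib]
  | succ n ih =>
    show 1 - f (ω n) (1 - fib (fun c y => 1 - f c (1 - y)) ω n x) = _
    rw [ih, sub_sub_cancel]; rfl

lemma flip_mem {x : ℝ} (hx : x ∈ Ioo (0:ℝ) 1) : 1 - x ∈ Ioo (0:ℝ) 1 :=
  ⟨by linarith [hx.2], by linarith [hx.1]⟩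

lemma avg_bdd (u : ℕ → ℝ) (hu : ∀ n, u n ∈ Ioo (0:ℝ) 1) (n : ℕ) :
    (n:ℝ)⁻¹ * ∑ j ∈ Finset.range n, u j ∈ Icc (0:ℝ) 1 := by
  constructor
  · exact mul_nonneg (by positivity) (Finset.sum_nonneg fun j _ => (hu j).1.le)
  · rw [inv_mul_eq_div]
    refine div_le_one_of_le₀ ?_ (by positivity)
    calc _ ≤ ∑ j ∈ Finset.range n, (1:ℝ) := Finset.sum_le_sum fun j _ => (hu j).2.le
      _ = n := by simp

lemma liminf_of_TT (γ : ℝ) (u : ℕ → ℝ) (hu : ∀ n, u n ∈ Ioo (0:ℝ) 1) (h : u ∈ TT γ) :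
    liminf (fun n : ℕ => (n:ℝ)⁻¹ * ∑ j ∈ Finset.range n, u j) atTop ≤ γ := by
  refine le_of_forall_pos_le_add fun ε hε => ?_
  obtain ⟨k, hk⟩ := exists_nat_one_div_lt hε
  refine liminf_le_of_frequently_le ?_ ?_
  · rw [frequently_atTop]
    intro N
    obtain ⟨n, hn, hs⟩ := h k (N + 1)
    refine ⟨n, by omega, ?_⟩
    have hn0 : (0:ℝ) < n := by exact_mod_cast (by omega : 0 < n)
    rw [inv_mul_eq_div, div_le_iff₀ hn0]
    nlinarith
  · refine ⟨0, ?_⟩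
    simp only [eventually_map]
    exact Eventually.of_forall fun n => (avg_bdd u hu n).1

lemma limsup_of_TT (γ : ℝ) (u : ℕ → ℝ) (hu : ∀ n, u n ∈ Ioo (0:ℝ) 1)
    (h : (fun n => 1 - u n) ∈ TT (1 - γ)) :
    γ ≤ limsup (fun n : ℕ => (n:ℝ)⁻¹ * ∑ j ∈ Finset.range n, u j) atTop := by
  refine le_of_forall_pos_sub_le fun ε hε => ?_
  obtain ⟨k, hk⟩ := exists_nat_one_div_lt hε
  refine le_limsup_of_frequently_le ?_ ?_
  · rw [frequently_atTop]
    intro N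
    obtain ⟨n, hn, hs⟩ := h k (N + 1)
    refine ⟨n, by omega, ?_⟩
    have hn0 : (0:ℝ) < n := by exact_mod_cast (by omega : 0 < n)
    rw [Finset.sum_sub_distrib] at hs
    simp only [Finset.sum_const, Finset.card_range, nsmul_eq_mul, mul_one] at hs
    rw [inv_mul_eq_div, le_div_iff₀ hn0]
    nlinarith
  · refine ⟨1, ?_⟩
    simp only [eventually_map]
    exact Eventually.of_forall fun n => (avg_bdd u hu n).2

lemma ind_mem (s : Set ℝ) (x : ℝ) : s.indicator (1 : ℝ → ℝ) x ∈ Icc (0:ℝ) 1 := by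
  by_cases h : x ∈ s <;> simp [h]

theorem statement2 {𝒜 : Type*} [Countable 𝒜] [MeasurableSpace 𝒜] [MeasurableSingletonClass 𝒜]
    (p : Measure 𝒜) [IsProbabilityMeasure p] (hp : ∀ c : 𝒜, 0 < p {c})
    (ℙ : Measure (ℕ → 𝒜)) [IsProbabilityMeasure ℙ] (hPr : IsBernoulli p ℙ)
    (f : 𝒜 → ℝ → ℝ) (hfm : ∀ c, Measurable (f c))
    (hfI : ∀ c, MapsTo (f c) (Icc (0:ℝ) 1) (Icc (0:ℝ) 1))
    (hH0 : ∀ x ∈ Ioo (0:ℝ) 1, TailTrivial ℙ fun n ω => fib f ω n x)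
    (hH1 : ∀ c, MapsTo (f c) (Ioo (0:ℝ) 1) (Ioo (0:ℝ) 1) ∧ MonotoneOn (f c) (Ioo (0:ℝ) 1))
    (hH2 : ∀ x ∈ Ioo (0:ℝ) 1, ∃ a b : 𝒜, f a x < x ∧ x < f b x)
    (γ₀ γ₁ : ℝ) (hγ₀ : γ₀ ∈ Ioo (0:ℝ) 1) (hγ₁ : γ₁ ∈ Ioo (0:ℝ) 1) (hγ : γ₀ < γ₁)
    (x₀ x₁ : ℝ) (hx₀ : x₀ ∈ Ioo (0:ℝ) 1) (hx₁ : x₁ ∈ Ioo (0:ℝ) 1)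
    (hOT0 : ∀ᵐ ω ∂ℙ, Filter.limsup (fun n : ℕ => (n:ℝ)⁻¹ *
      ∑ j ∈ Finset.range n, (Icc (0:ℝ) γ₀).indicator 1 (fib f ω j x₀)) atTop = 1)
    (hOT1 : ∀ᵐ ω ∂ℙ, Filter.limsup (fun n : ℕ => (n:ℝ)⁻¹ *
      ∑ j ∈ Finset.range n, (Icc γ₁ (1:ℝ)).indicator 1 (fib f ω j x₁)) atTop = 1) :
    ∀ x ∈ Ioo (0:ℝ) 1, ∀ᵐ ω ∂ℙ,
      Filter.liminf (fun n : ℕ => (n:ℝ)⁻¹ * ∑ j ∈ Finset.range n, fib f ω j x) atTop ≤ γ₀ ∧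
      γ₁ ≤ Filter.limsup (fun n : ℕ => (n:ℝ)⁻¹ * ∑ j ∈ Finset.range n, fib f ω j x) atTop := by
  intro x hx
  have hm := fun c => (hH1 c).1
  have hmo := fun c => (hH1 c).2
  have A := core p hp ℙ hPr f hfm hH0 hm hmo hH2 γ₀ hγ₀.1.le x₀ hx₀ (by
    filter_upwards [hOT0] with ω hω
    refine TT_of_limsup γ₀ hγ₀ _ _ (fun n => ind_mem (Icc (0:ℝ) γ₀) (fib f ω n x₀)) ?_ hω
    intro n
    have := fib_mem f hm ω hx₀ n
    by_cases hc : fib f ω n x₀ ∈ Icc (0:ℝ) γ₀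
    · simp only [indicator_of_mem hc, Pi.one_apply]; linarith [hc.2]
    · simp only [indicator_of_notMem hc]; linarith [this.2]) x hx
  have B := core p hp ℙ hPr (fun c y => 1 - f c (1 - y))
    (fun c => measurable_const.sub ((hfm c).comp (measurable_const.sub measurable_id)))
    (by
      intro y hy s hs
      refine hH0 (1 - y) (flip_mem hy) s ?_
      rw [MeasurableSpace.measurableSet_iInf] at hs ⊢
      intro m
      have hle : (⨆ (n : ℕ) (_ : m ≤ n), MeasurableSpace.comap
          (fun ω => fib (fun c y => 1 - f c (1 - y)) ω n y) (inferInstance : MeasurableSpace ℝ)) ≤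
          ⨆ (n : ℕ) (_ : m ≤ n), MeasurableSpace.comap
          (fun ω => fib f ω n (1 - y)) (inferInstance : MeasurableSpace ℝ) := by
        refine iSup₂_mono fun n _ => ?_
        rintro t ⟨r, hr, rfl⟩
        refine ⟨(fun q : ℝ => 1 - q) ⁻¹' r, (measurable_const.sub measurable_id) hr, ?_⟩
        ext ω
        simp [fib_conj]
      exact hle s (hs m))
    (fun c y hy => flip_mem (hm c (flip_mem hy)))
    (fun c y hy z hz hyz => by
      have := hmo c (flip_mem hz) (flip_mem hy) (by linarith)
      dsimp only; linarith)
    (fun y hy => by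
      obtain ⟨a, b, ha, hb⟩ := hH2 (1 - y) (flip_mem hy)
      exact ⟨b, a, by linarith, by linarith⟩)
    (1 - γ₁) (flip_mem hγ₁).1.le (1 - x₁) (flip_mem hx₁) (by
      filter_upwards [hOT1] with ω hω
      refine TT_of_limsup (1 - γ₁) (flip_mem hγ₁) _ _
        (fun n => ind_mem (Icc γ₁ (1:ℝ)) (fib f ω n x₁)) ?_ hω
      intro n
      rw [fib_conj, sub_sub_cancel]
      have := fib_mem f hm ω hx₁ n
      by_cases hc : fib f ω n x₁ ∈ Icc γ₁ (1:ℝ)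
      · simp only [indicator_of_mem hc, Pi.one_apply]; linarith [hc.1]
      · simp only [indicator_of_notMem hc]; linarith [this.1]) (1 - x) (flip_mem hx)
  filter_upwards [A, B] with ω hA hB
  refine ⟨liminf_of_TT γ₀ _ (fun n => fib_mem f hm ω hx n) hA,
    limsup_of_TT γ₁ _ (fun n => fib_mem f hm ω hx n) ?_⟩
  simpa only [fib_conj, sub_sub_cancel] using hB
end
end

section
/- Let F be a one-step skew product satisfying condition (H0), and suppose F satisfies the pointwise-fiber fluctuation law with constants γ₀, γ₁ ∈ (0,1) and points x₀, x₁ ∈ (0,1): for i = 0,1 and every α ∈ (0,1), liminf_{n→∞} ℙ( { ω : (1/n)∑_{j=0}^{n-1} 1_{I_i(γ_i)}(f_ω^j(x_i)) ≤ α } ) < 1. Then for i = 0,1: limsup_{n→∞} (1/n)∑_{j=0}^{n-1} 1_{I_i(γ_i)}(f_ω^j(x_i)) = 1 for ℙ-almost every ω ∈ Ω. -/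
open MeasureTheory Filter Set

noncomputable section

/-- Birkhoff-type averages. -/
def avg {Ω : Type*} (X : ℕ → Ω → ℝ) (B : Set ℝ) (n : ℕ) (ω : Ω) : ℝ :=
  (n:ℝ)⁻¹ * ∑ j ∈ Finset.range n, B.indicator 1 (X j ω)

/-- Averages forgetting the first `m` terms. -/
def avgFrom {Ω : Type*} (X : ℕ → Ω → ℝ) (B : Set ℝ) (m n : ℕ) (ω : Ω) : ℝ :=
  (n:ℝ)⁻¹ * ∑ j ∈ Finset.range n, if m ≤ j then B.indicator 1 (X j ω) else 0

lemma ind_nonneg (B : Set ℝ) (y : ℝ) : (0:ℝ) ≤ B.indicator 1 y :=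
  Set.indicator_nonneg (fun _ _ => zero_le_one) y

lemma ind_le (B : Set ℝ) (y : ℝ) : B.indicator 1 y ≤ (1:ℝ) := by
  by_cases h : y ∈ B <;> simp [h]

lemma avg_nonneg {Ω : Type*} (X : ℕ → Ω → ℝ) (B : Set ℝ) (n : ℕ) (ω : Ω) : 0 ≤ avg X B n ω :=
  mul_nonneg (by positivity) (Finset.sum_nonneg fun j _ => ind_nonneg B _)

lemma avg_le_one {Ω : Type*} (X : ℕ → Ω → ℝ) (B : Set ℝ) (n : ℕ) (ω : Ω) : avg X B n ω ≤ 1 := by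
  unfold avg
  have h : ∑ j ∈ Finset.range n, B.indicator 1 (X j ω) ≤ (n:ℝ) := by
    calc _ ≤ ∑ j ∈ Finset.range n, (1:ℝ) := Finset.sum_le_sum fun j _ => ind_le B _
      _ = n := by simp
  calc _ ≤ (n:ℝ)⁻¹ * n := by gcongr
    _ ≤ 1 := inv_mul_le_one

lemma avgFrom_le {Ω : Type*} (X : ℕ → Ω → ℝ) (B : Set ℝ) (m n : ℕ) (ω : Ω) :
    avgFrom X B m n ω ≤ avg X B n ω := by
  unfold avg avgFrom
  gcongr with j hj
  split_ifs
  · exact le_rfl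
  · exact ind_nonneg B _

lemma avg_le_avgFrom {Ω : Type*} (X : ℕ → Ω → ℝ) (B : Set ℝ) (m n : ℕ) (ω : Ω) :
    avg X B n ω ≤ avgFrom X B m n ω + (n:ℝ)⁻¹ * m := by
  unfold avg avgFrom
  rw [← mul_add]
  gcongr
  have h : ∑ j ∈ Finset.range n, (if m ≤ j then (0:ℝ) else 1) ≤ m := by
    have e : ∀ j ∈ Finset.range n, (if m ≤ j then (0:ℝ) else 1) = if ¬ m ≤ j then 1 else 0 := by
      intro j _
      split_ifs <;> rfl
    rw [Finset.sum_congr rfl e, ← Finset.sum_filter, Finset.sum_const, nsmul_eq_mul, mul_one]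
    have : (Finset.range n).filter (fun j => ¬ m ≤ j) ⊆ Finset.range m := by
      intro j; simp
    have h2 := Finset.card_le_card this
    rw [Finset.card_range] at h2
    exact_mod_cast h2
  refine le_trans ?_ (add_le_add_right h _)
  rw [← Finset.sum_add_distrib]
  refine Finset.sum_le_sum fun j _ => ?_
  split_ifs
  · simp
  · simpa using ind_le B _

/-- The event that the limsup is at least `a`. -/
def evt {Ω : Type*} (A : ℕ → Ω → ℝ) (a : ℝ) : Set Ω :=
  {ω | ∀ k : ℕ, ∃ᶠ n in atTop, a - 1 / ((k:ℝ) + 1) < A n ω}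

lemma evt_eq {Ω : Type*} (X : ℕ → Ω → ℝ) (B : Set ℝ) (m : ℕ) (a : ℝ) :
    evt (avg X B) a = evt (avgFrom X B m) a := by
  ext ω
  constructor
  · intro h k
    have hlt : 1 / (((k+1:ℕ):ℝ) + 1) < 1 / ((k:ℝ) + 1) := by
      push_cast
      apply one_div_lt_one_div_of_lt <;> linarith [Nat.cast_nonneg (α := ℝ) k]
    have ht : Tendsto (fun n : ℕ => (n:ℝ)⁻¹ * m) atTop (nhds 0) := by
      simpa using (tendsto_inv_atTop_nhds_zero_nat (𝕜 := ℝ)).mul_const (m:ℝ)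
    have he := ht.eventually (gt_mem_nhds (sub_pos.2 hlt))
    refine ((h (k+1)).and_eventually he).mono ?_
    rintro n ⟨h1, h2⟩
    have := avg_le_avgFrom X B m n ω
    linarith
  · intro h k
    exact (h k).mono fun n hn => hn.trans_le (avgFrom_le X B m n ω)

lemma evt_meas {Ω : Type*} (mΩ : MeasurableSpace Ω) (A : ℕ → Ω → ℝ) (a : ℝ)
    (hA : ∀ n, Measurable (A n)) : MeasurableSet (evt A a) := by
  have : evt A a = ⋂ k : ℕ, ⋂ N : ℕ, ⋃ n : ℕ, ⋃ _ : N ≤ n,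
      {ω | a - 1 / ((k:ℝ) + 1) < A n ω} := by
    ext ω
    simp [evt, frequently_atTop]
  rw [this]
  exact MeasurableSet.iInter fun k => MeasurableSet.iInter fun N => MeasurableSet.iUnion fun n =>
    MeasurableSet.iUnion fun _ => measurableSet_lt measurable_const (hA n)

lemma ind_meas {B : Set ℝ} (hB : MeasurableSet B) : Measurable (B.indicator (1 : ℝ → ℝ)) :=
  measurable_one.indicator hB

lemma avgFrom_meas {Ω : Type*} (mΩ : MeasurableSpace Ω) (X : ℕ → Ω → ℝ) {B : Set ℝ}
    (hB : MeasurableSet B) (m n : ℕ) (hX : ∀ j, m ≤ j → Measurable (X j)) :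
    Measurable (avgFrom X B m n) := by
  unfold avgFrom
  refine Measurable.const_mul (Finset.measurable_sum _ fun j _ => ?_) _
  by_cases h : m ≤ j
  · simp only [h, if_true]
    exact (ind_meas hB).comp (hX j h)
  · simp [h]

lemma evt_tail {Ω : Type*} (X : ℕ → Ω → ℝ) {B : Set ℝ} (hB : MeasurableSet B) (a : ℝ) :
    MeasurableSet[⨅ m : ℕ, ⨆ (n : ℕ) (_ : m ≤ n),
      MeasurableSpace.comap (X n) (inferInstance : MeasurableSpace ℝ)] (evt (avg X B) a) := by
  rw [MeasurableSpace.measurableSet_iInf]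
  intro m
  rw [evt_eq X B m]
  refine evt_meas _ _ _ fun n => avgFrom_meas _ X hB m n fun j hj => ?_
  rw [measurable_iff_comap_le]
  exact le_iSup₂ (f := fun (n : ℕ) (_ : m ≤ n) =>
    MeasurableSpace.comap (X n) (inferInstance : MeasurableSpace ℝ)) j hj

lemma key {Ω : Type*} [MeasurableSpace Ω] (P : Measure Ω) [IsProbabilityMeasure P]
    (X : ℕ → Ω → ℝ) (hX : ∀ n, Measurable (X n)) (hT : TailTrivial P X)
    {B : Set ℝ} (hB : MeasurableSet B)
    (h : ∀ a ∈ Ioo (0:ℝ) 1, liminf (fun n : ℕ => P {ω | avg X B n ω ≤ a}) atTop < 1) :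
    ∀ᵐ ω ∂P, limsup (fun n : ℕ => avg X B n ω) atTop = 1 := by
  have hA : ∀ n, Measurable (avg X B n) := fun n =>
    Measurable.const_mul (Finset.measurable_sum _ fun j _ => (ind_meas hB).comp (hX j)) _
  have h1 : ∀ a ∈ Ioo (0:ℝ) 1, ∀ᵐ ω ∂P, ω ∈ evt (avg X B) a := by
    intro a ha
    rcases hT _ (evt_tail X hB a) with h0 | h0
    · exfalso
      set G : ℕ → Set Ω := fun N => {ω | ∀ n, N ≤ n → avg X B n ω ≤ a} with hG
      have hmono : Monotone G := fun M N hMN ω hω n hn => hω n (hMN.trans hn)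
      have hae : ∀ᵐ ω ∂P, ω ∈ ⋃ N, G N := by
        have : ∀ᵐ ω ∂P, ω ∉ evt (avg X B) a := measure_eq_zero_iff_ae_notMem.1 h0
        filter_upwards [this] with ω hω
        simp only [evt, mem_ofPred_eq, not_forall, not_frequently, not_lt] at hω
        obtain ⟨k, hk⟩ := hω
        obtain ⟨N, hN⟩ := eventually_atTop.1 hk
        refine mem_iUnion.2 ⟨N, fun n hn => ?_⟩
        have : 0 < 1 / ((k:ℝ) + 1) := by positivity
        linarith [hN n hn]
      have hone : P (⋃ N, G N) = 1 := by
        have hu : (⋃ N, G N) =ᵐ[P] (univ : Set Ω) := by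
          rw [ae_eq_univ]; exact hae
        rw [measure_congr hu, measure_univ]
      rw [hmono.measure_iUnion] at hone
      have hle : ⨆ N, P (G N) ≤ liminf (fun n : ℕ => P {ω | avg X B n ω ≤ a}) atTop := by
        rw [liminf_eq_iSup_iInf_of_nat]
        exact iSup_mono fun N => le_iInf₂ fun n hn => measure_mono fun ω hω => hω n hn
      rw [hone] at hle
      exact absurd (h a ha) (not_lt.2 hle)
    · exact (mem_ae_iff_prob_eq_one (evt_meas _ _ _ hA)).2 h0
  have h2 : ∀ᵐ ω ∂P, ∀ k : ℕ, ω ∈ evt (avg X B) (1 - 1 / ((k:ℝ) + 2)) := by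
    rw [ae_all_iff]
    intro k
    have hk := Nat.cast_nonneg (α := ℝ) k
    have : 1 / ((k:ℝ) + 2) < 1 := by rw [div_lt_one] <;> linarith
    have : 0 < 1 / ((k:ℝ) + 2) := by positivity
    exact h1 _ ⟨by linarith, by linarith⟩
  filter_upwards [h2] with ω hω
  have hbdd : IsBoundedUnder (· ≤ ·) atTop (fun n : ℕ => avg X B n ω) :=
    isBoundedUnder_of ⟨1, fun n => avg_le_one X B n ω⟩
  have hcob : IsCoboundedUnder (· ≤ ·) atTop (fun n : ℕ => avg X B n ω) :=
    (isBoundedUnder_of ⟨0, fun n => avg_nonneg X B n ω⟩ :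
      IsBoundedUnder (· ≥ ·) atTop (fun n : ℕ => avg X B n ω)).isCoboundedUnder_le
  apply le_antisymm
  · exact limsup_le_of_le hcob (Eventually.of_forall fun n => avg_le_one X B n ω)
  · refine le_of_forall_pos_le_add fun ε hε => ?_
    obtain ⟨k, hk⟩ := exists_nat_one_div_lt (half_pos hε)
    have hk2 : 1 / ((k:ℝ) + 2) ≤ 1 / ((k:ℝ) + 1) := by
      apply one_div_le_one_div_of_le <;> linarith [Nat.cast_nonneg (α := ℝ) k]
    have := le_limsup_of_frequently_le ((hω k k).mono fun n hn => hn.le) hbdd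
    linarith

lemma fib_meas {𝒜 : Type*} [Countable 𝒜] [MeasurableSpace 𝒜] [MeasurableSingletonClass 𝒜]
    (f : 𝒜 → ℝ → ℝ) (hfm : ∀ c, Measurable (f c)) (x : ℝ) (n : ℕ) :
    Measurable (fun ω : ℕ → 𝒜 => fib f ω n x) := by
  induction n with
  | zero => exact measurable_const
  | succ n ih =>
    have h : Measurable (fun q : 𝒜 × ℝ => f q.1 q.2) :=
      measurable_from_prod_countable_right hfm
    exact h.comp ((measurable_pi_apply n).prodMk ih)

theorem statement6 {𝒜 : Type*} [Countable 𝒜] [MeasurableSpace 𝒜] [MeasurableSingletonClass 𝒜]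
    (p : Measure 𝒜) [IsProbabilityMeasure p] (hp : ∀ c : 𝒜, 0 < p {c})
    (ℙ : Measure (ℕ → 𝒜)) [IsProbabilityMeasure ℙ] (hPr : IsBernoulli p ℙ)
    (f : 𝒜 → ℝ → ℝ) (hfm : ∀ c, Measurable (f c))
    (hfI : ∀ c, MapsTo (f c) (Icc (0:ℝ) 1) (Icc (0:ℝ) 1))
    (hH0 : ∀ x ∈ Ioo (0:ℝ) 1, TailTrivial ℙ fun n ω => fib f ω n x)
    (γ₀ γ₁ : ℝ) (hγ₀ : γ₀ ∈ Ioo (0:ℝ) 1) (hγ₁ : γ₁ ∈ Ioo (0:ℝ) 1)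
    (x₀ x₁ : ℝ) (hx₀ : x₀ ∈ Ioo (0:ℝ) 1) (hx₁ : x₁ ∈ Ioo (0:ℝ) 1)
    (hFL0 : ∀ α ∈ Ioo (0:ℝ) 1,
      Filter.liminf (fun n : ℕ => ℙ {ω | (n:ℝ)⁻¹ *
        ∑ j ∈ Finset.range n, (Icc (0:ℝ) γ₀).indicator 1 (fib f ω j x₀) ≤ α}) atTop < 1)
    (hFL1 : ∀ α ∈ Ioo (0:ℝ) 1,
      Filter.liminf (fun n : ℕ => ℙ {ω | (n:ℝ)⁻¹ *
        ∑ j ∈ Finset.range n, (Icc γ₁ (1:ℝ)).indicator 1 (fib f ω j x₁) ≤ α}) atTop < 1) :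
    (∀ᵐ ω ∂ℙ, Filter.limsup (fun n : ℕ => (n:ℝ)⁻¹ *
        ∑ j ∈ Finset.range n, (Icc (0:ℝ) γ₀).indicator 1 (fib f ω j x₀)) atTop = 1) ∧
    (∀ᵐ ω ∂ℙ, Filter.limsup (fun n : ℕ => (n:ℝ)⁻¹ *
        ∑ j ∈ Finset.range n, (Icc γ₁ (1:ℝ)).indicator 1 (fib f ω j x₁)) atTop = 1) := by
  exact ⟨key ℙ _ (fib_meas f hfm x₀) (hH0 x₀ hx₀) measurableSet_Icc hFL0,
    key ℙ _ (fib_meas f hfm x₁) (hH0 x₁ hx₁) measurableSet_Icc hFL1⟩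
end
end
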